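/- Let (X, ℬ) be a measurable space, S a sub-Markov kernel on X, δ > 0, and μ, ν probability measures on X with (μS)(X) ≥ δ and (νS)(X) ≥ δ; define K_μ and K_ν as the Markov kernels K_μ(x, A) := S(x, A) + (1 − S(x, X)) (μS)(A)/(μS)(X), and analogously K_ν. Then for every j ≥ 1 and every bounded measurable f : X → ℝ, sup_{x ∈ X} | K_μ^j(x, f) − K_ν^j(x, f) | ≤ (2/δ) · 2^j · ‖f‖_∞ · ‖ μ − ν ‖_TV. -/

import Mathlib

open MeasureTheory ProbabilityTheory

/-- The `n`-fold iterate of a kernel. -/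
noncomputable def iterK {X : Type*} [MeasurableSpace X] (S : Kernel X X) :
    ℕ → Kernel X X
  | 0 => Kernel.id
  | n + 1 => Kernel.comp S (iterK S n)

/-- The total variation distance between two measures, defined as
`sup { |α(f) − β(f)| : f measurable, ‖f‖_∞ ≤ 1 }`. -/
noncomputable def tvDist {X : Type*} [MeasurableSpace X]
    (α β : Measure X) : ℝ :=
  ⨆ f : {f : X → ℝ // Measurable f ∧ ∀ x, |f x| ≤ 1},
    |(∫ x, f.1 x ∂α) - ∫ x, f.1 x ∂β|

section BoundedIntegrals

variable {X Y : Type*} [MeasurableSpace X] [MeasurableSpace Y]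

lemma integrable_of_forall_abs_le (α : Measure X) [IsFiniteMeasure α] {g : X → ℝ}
    (hg : Measurable g) {M : ℝ} (hM : ∀ x, |g x| ≤ M) : Integrable g α :=
  .of_bound hg.aestronglyMeasurable M (.of_forall hM)

lemma abs_integral_le_mul_real_univ (α : Measure X) [IsFiniteMeasure α] {g : X → ℝ} {M : ℝ}
    (hM : ∀ x, |g x| ≤ M) : |∫ x, g x ∂α| ≤ M * α.real Set.univ :=
  norm_integral_le_of_norm_le_const (f := g) (.of_forall hM)

lemma abs_integral_le_of_forall_abs_le (α : Measure X) [IsProbabilityMeasure α] {g : X → ℝ}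
    {M : ℝ} (hM : ∀ x, |g x| ≤ M) : |∫ x, g x ∂α| ≤ M := by
  simpa using abs_integral_le_mul_real_univ α hM

/-- The integral of a bounded function against the image of a measure under a finite kernel. -/
lemma integral_bind_kernel (α : Measure X) [IsFiniteMeasure α] (S : Kernel X Y) [IsFiniteKernel S]
    {g : Y → ℝ} (hg : Measurable g) {M : ℝ} (hM : ∀ x, |g x| ≤ M) :
    ∫ y, g y ∂(α.bind (fun x => S x)) = ∫ x, ∫ y, g y ∂(S x) ∂α := by
  have h := Kernel.integral_comp (η := S) (κ := Kernel.const Unit α) (a := ()) (f := g)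
    (integrable_of_forall_abs_le _ hg hM)
  rwa [Kernel.comp_apply, Kernel.const_apply] at h

end BoundedIntegrals

section TotalVariation

variable {X : Type*} [MeasurableSpace X] (μ ν : Measure X)
  [IsProbabilityMeasure μ] [IsProbabilityMeasure ν]

lemma tvDist_nonneg (α β : Measure X) : 0 ≤ tvDist α β :=
  Real.iSup_nonneg fun _ => abs_nonneg _

lemma abs_integral_sub_le_tvDist {g : X → ℝ} (hg : Measurable g) (h1 : ∀ x, |g x| ≤ 1) :
    |(∫ x, g x ∂μ) - ∫ x, g x ∂ν| ≤ tvDist μ ν := by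
  refine le_ciSup (f := fun f : {f : X → ℝ // Measurable f ∧ ∀ x, |f x| ≤ 1} =>
    |(∫ x, f.1 x ∂μ) - ∫ x, f.1 x ∂ν|) ⟨1 + 1, ?_⟩ ⟨g, hg, h1⟩
  rintro _ ⟨f, rfl⟩
  exact (abs_sub _ _).trans (add_le_add (abs_integral_le_of_forall_abs_le μ f.2.2)
    (abs_integral_le_of_forall_abs_le ν f.2.2))

lemma abs_integral_sub_le_mul_tvDist {g : X → ℝ} (hg : Measurable g) {M : ℝ} (hM0 : 0 ≤ M)
    (hM : ∀ x, |g x| ≤ M) :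
    |(∫ x, g x ∂μ) - ∫ x, g x ∂ν| ≤ M * tvDist μ ν := by
  rcases hM0.eq_or_lt with rfl | hpos
  · have h0 : ∀ x, g x = 0 := fun x => abs_nonpos_iff.1 (hM x)
    simp [h0]
  · have h := abs_integral_sub_le_tvDist μ ν (g := fun x => g x / M) (hg.div_const M) fun x => by
      rw [abs_div, abs_of_pos hpos]
      exact div_le_one_of_le₀ (hM x) hM0
    rwa [integral_div, integral_div, ← sub_div, abs_div, abs_of_pos hpos, div_le_iff₀' hpos] at h

end TotalVariation

section Rebirth

variable {X : Type*} [MeasurableSpace X]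

/-- The action of a rebirth kernel on a bounded function. -/
lemma integral_rebirth (S : Kernel X X) [IsFiniteKernel S] (hS : ∀ x, S x Set.univ ≤ 1)
    (μ : Measure X) [IsProbabilityMeasure μ] (hμ : μ.bind (fun x => S x) Set.univ ≠ 0)
    (K : Kernel X X)
    (hK : ∀ x (A : Set X), MeasurableSet A →
      K x A = S x A + (1 - S x Set.univ)
        * ((μ.bind (fun z => S z)) A / (μ.bind (fun z => S z)) Set.univ))
    {g : X → ℝ} (hg : Measurable g) {M : ℝ} (hM : ∀ x, |g x| ≤ M) (x : X) :
    ∫ y, g y ∂(K x) = ∫ y, g y ∂(S x) + (1 - (S x).real Set.univ)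
      * ((∫ z, ∫ y, g y ∂(S z) ∂μ) / ∫ z, (S z).real Set.univ ∂μ) := by
  have hfin : IsFiniteMeasure (μ.bind (fun z => S z)) :=
    inferInstanceAs (IsFiniteMeasure (μ.bind S))
  have hmeas : K x = S x + (1 - S x Set.univ) •
      ((μ.bind (fun z => S z)) Set.univ)⁻¹ • μ.bind (fun z => S z) := by
    ext A hA
    rw [hK x A hA]
    simp [div_eq_mul_inv, mul_comm]
  have hmass : ((μ.bind (fun z => S z)) Set.univ).toReal = ∫ z, (S z).real Set.univ ∂μ := by
    simpa [Measure.real] using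
      integral_bind_kernel μ S (g := fun _ => 1) measurable_const (M := 1) (by simp)
  have hint := integrable_of_forall_abs_le (μ.bind (fun z => S z)) hg hM
  rw [hmeas, integral_add_measure (integrable_of_forall_abs_le _ hg hM)
    ((hint.smul_measure (ENNReal.inv_ne_top.2 hμ)).smul_measure
      (ENNReal.sub_ne_top ENNReal.one_ne_top)),
    integral_smul_measure, integral_smul_measure, integral_bind_kernel μ S hg hM,
    ENNReal.toReal_inv, hmass, ENNReal.toReal_sub_of_le (hS x) ENNReal.one_ne_top]
  simp only [ENNReal.toReal_one, smul_eq_mul, Measure.real, div_eq_inv_mul]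

lemma abs_div_sub_div_le {a b c d δ M t : ℝ} (hδ : 0 < δ) (hb : δ ≤ b) (hd : 0 < d)
    (hac : |a - c| ≤ M * t) (hbd : |b - d| ≤ t) (hc : |c| ≤ M * d) (hM : 0 ≤ M) (ht : 0 ≤ t) :
    |a / b - c / d| ≤ 2 / δ * M * t := by
  have hb0 : 0 < b := hδ.trans_le hb
  have hcd : |c / d| ≤ M := by
    rw [abs_div, abs_of_pos hd]
    exact (div_le_iff₀ hd).2 hc
  have hsplit : a / b - c / d = ((a - c) - c / d * (b - d)) / b := by
    field_simp
    ring
  rw [hsplit, abs_div, abs_of_pos hb0]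
  calc |(a - c) - c / d * (b - d)| / b ≤ (M * t + M * t) / b := by
        gcongr
        refine (abs_sub _ _).trans (add_le_add hac ?_)
        rw [abs_mul]
        gcongr
    _ ≤ (M * t + M * t) / δ := by gcongr
    _ = 2 / δ * M * t := by ring

lemma abs_integral_rebirth_sub_le (S : Kernel X X) (hS : ∀ x, S x Set.univ ≤ 1)
    {δ : ℝ} (hδ : 0 < δ)
    (μ ν : Measure X) [IsProbabilityMeasure μ] [IsProbabilityMeasure ν]
    (hμ : ENNReal.ofReal δ ≤ (μ.bind (fun x => S x)) Set.univ)
    (hν : ENNReal.ofReal δ ≤ (ν.bind (fun x => S x)) Set.univ)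
    (Kμ Kν : Kernel X X)
    (hKμ : ∀ x (A : Set X), MeasurableSet A →
      Kμ x A = S x A + (1 - S x Set.univ)
        * ((μ.bind (fun z => S z)) A / (μ.bind (fun z => S z)) Set.univ))
    (hKν : ∀ x (A : Set X), MeasurableSet A →
      Kν x A = S x A + (1 - S x Set.univ)
        * ((ν.bind (fun z => S z)) A / (ν.bind (fun z => S z)) Set.univ))
    {g : X → ℝ} (hg : Measurable g) {M : ℝ} (hM : ∀ x, |g x| ≤ M) (x : X) :
    |(∫ y, g y ∂(Kμ x)) - ∫ y, g y ∂(Kν x)| ≤ 2 / δ * M * tvDist μ ν := by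
  have hSfin : IsFiniteKernel S := ⟨⟨1, ENNReal.one_lt_top, hS⟩⟩
  have hM0 : 0 ≤ M := (abs_nonneg _).trans (hM x)
  have hS1 : ∀ z, (S z).real Set.univ ≤ 1 := fun z =>
    ENNReal.toReal_le_of_le_ofReal zero_le_one (by simpa using hS z)
  have hmassMeas : Measurable fun z => (S z).real Set.univ :=
    (S.measurable_coe .univ).ennreal_toReal
  have hmassAbs : ∀ z, |(S z).real Set.univ| ≤ 1 := fun z => by
    rw [abs_of_nonneg measureReal_nonneg]
    exact hS1 z
  have hSgMeas : Measurable fun z => ∫ y, g y ∂(S z) :=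
    hg.stronglyMeasurable.integral_kernel.measurable
  have hSg : ∀ z, |∫ y, g y ∂(S z)| ≤ M * (S z).real Set.univ := fun z =>
    abs_integral_le_mul_real_univ _ hM
  have hmass : ∀ (α : Measure X) [IsProbabilityMeasure α],
      ENNReal.ofReal δ ≤ (α.bind (fun x => S x)) Set.univ →
      δ ≤ ∫ z, (S z).real Set.univ ∂α := fun α _ hα => by
    have hfin : IsFiniteMeasure (α.bind (fun z => S z)) :=
      inferInstanceAs (IsFiniteMeasure (α.bind S))
    have h := integral_bind_kernel α S (g := fun _ => 1) measurable_const (M := 1) (by simp)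
    simp only [integral_const, smul_eq_mul, mul_one] at h
    rw [← h]
    exact (ENNReal.ofReal_le_iff_le_toReal (measure_ne_top _ _)).1 hα
  have hne : ∀ {c : ENNReal}, ENNReal.ofReal δ ≤ c → c ≠ 0 := fun h =>
    ((ENNReal.ofReal_pos.2 hδ).trans_le h).ne'
  rw [integral_rebirth S hS μ (hne hμ) Kμ hKμ hg hM x,
    integral_rebirth S hS ν (hne hν) Kν hKν hg hM x, add_sub_add_left_eq_sub, ← mul_sub, abs_mul,
    abs_of_nonneg (sub_nonneg.2 (hS1 x))]
  refine (mul_le_of_le_one_left (abs_nonneg _)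
    (sub_le_self _ measureReal_nonneg)).trans ?_
  refine abs_div_sub_div_le hδ (hmass μ hμ) (hδ.trans_le (hmass ν hν))
    (abs_integral_sub_le_mul_tvDist μ ν hSgMeas hM0 fun z =>
      (hSg z).trans (mul_le_of_le_one_right hM0 (hS1 z)))
    (abs_integral_sub_le_tvDist μ ν hmassMeas hmassAbs) ?_ hM0 (tvDist_nonneg μ ν)
  rw [← integral_const_mul]
  exact norm_integral_le_of_norm_le (f := fun z => ∫ y, g y ∂(S z))
    ((integrable_of_forall_abs_le ν hmassMeas hmassAbs).const_mul M) (.of_forall hSg)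

end Rebirth

section Iterates

variable {X : Type*} [MeasurableSpace X]

instance isMarkovKernel_iterK (K : Kernel X X) [IsMarkovKernel K] :
    ∀ n, IsMarkovKernel (iterK K n)
  | 0 => inferInstanceAs (IsMarkovKernel Kernel.id)
  | n + 1 =>
    have := isMarkovKernel_iterK K n
    inferInstanceAs (IsMarkovKernel (Kernel.comp K (iterK K n)))

lemma integral_iterK_succ (K : Kernel X X) [IsMarkovKernel K] (n : ℕ) {g : X → ℝ}
    (hg : Measurable g) {M : ℝ} (hM : ∀ x, |g x| ≤ M) (x : X) :
    ∫ y, g y ∂(iterK K (n + 1) x) = ∫ z, ∫ y, g y ∂(K z) ∂(iterK K n x) := by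
  rw [iterK]
  exact Kernel.integral_comp (integrable_of_forall_abs_le _ hg hM)

/-- A uniform one-step comparison of two Markov kernels on functions bounded by `M` grows at most
linearly along the iterates. -/
lemma abs_integral_iterK_sub_le (K L : Kernel X X) [IsMarkovKernel K] [IsMarkovKernel L]
    {M C : ℝ}
    (hKL : ∀ g : X → ℝ, Measurable g → (∀ x, |g x| ≤ M) →
      ∀ x, |(∫ y, g y ∂(K x)) - ∫ y, g y ∂(L x)| ≤ C)
    (n : ℕ) {g : X → ℝ} (hg : Measurable g) (hM : ∀ x, |g x| ≤ M) (x : X) :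
    |(∫ y, g y ∂(iterK K n x)) - ∫ y, g y ∂(iterK L n x)| ≤ n * C := by
  induction n generalizing g with
  | zero => simp [iterK]
  | succ n ih =>
    have hKMeas : Measurable fun z => ∫ y, g y ∂(K z) :=
      hg.stronglyMeasurable.integral_kernel.measurable
    have hLMeas : Measurable fun z => ∫ y, g y ∂(L z) :=
      hg.stronglyMeasurable.integral_kernel.measurable
    have hKM : ∀ z, |∫ y, g y ∂(K z)| ≤ M := fun z => abs_integral_le_of_forall_abs_le _ hM
    have hLM : ∀ z, |∫ y, g y ∂(L z)| ≤ M := fun z => abs_integral_le_of_forall_abs_le _ hM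
    have hstep := abs_integral_le_of_forall_abs_le (iterK K n x) (hKL g hg hM)
    rw [integral_sub (integrable_of_forall_abs_le _ hKMeas hKM)
      (integrable_of_forall_abs_le _ hLMeas hLM)] at hstep
    rw [integral_iterK_succ K n hg hM, integral_iterK_succ L n hg hM]
    refine (abs_sub_le _ (∫ z, ∫ y, g y ∂(L z) ∂(iterK K n x)) _).trans ?_
    push_cast
    linarith [ih hLMeas hLM]

end Iterates

/-- Lipschitz property of the iterated rebirth kernels applied to a bounded
measurable function `f`:
`sup_x |K_μ^j(x,f) − K_ν^j(x,f)| ≤ (2/δ)·2^j·‖f‖_∞·‖μ − ν‖_TV`. -/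
theorem stmt8 {X : Type*} [MeasurableSpace X] (S : Kernel X X)
    (hS : ∀ x, S x Set.univ ≤ 1)
    (δ : ℝ) (hδ : 0 < δ)
    (μ ν : Measure X) [IsProbabilityMeasure μ] [IsProbabilityMeasure ν]
    (hμ : ENNReal.ofReal δ ≤ (μ.bind (fun x => S x)) Set.univ)
    (hν : ENNReal.ofReal δ ≤ (ν.bind (fun x => S x)) Set.univ)
    (Kμ Kν : Kernel X X) [IsMarkovKernel Kμ] [IsMarkovKernel Kν]
    (hKμ : ∀ x (A : Set X), MeasurableSet A →
      Kμ x A = S x A + (1 - S x Set.univ)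
        * ((μ.bind (fun z => S z)) A / (μ.bind (fun z => S z)) Set.univ))
    (hKν : ∀ x (A : Set X), MeasurableSet A →
      Kν x A = S x A + (1 - S x Set.univ)
        * ((ν.bind (fun z => S z)) A / (ν.bind (fun z => S z)) Set.univ))
    (j : ℕ) (hj : 1 ≤ j)
    (f : X → ℝ) (hf : Measurable f) (M : ℝ) (hfM : ∀ x, |f x| ≤ M) :
    ∀ x : X,
      |(∫ y, f y ∂((iterK Kμ j) x)) - ∫ y, f y ∂((iterK Kν j) x)|
        ≤ (2 / δ) * 2 ^ j * M * tvDist μ ν := by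
  intro x
  have hM0 : 0 ≤ M := (abs_nonneg _).trans (hfM x)
  have htv := tvDist_nonneg μ ν
  have hpow : (j : ℝ) ≤ 2 ^ j := by exact_mod_cast j.lt_two_pow_self.le
  calc |(∫ y, f y ∂((iterK Kμ j) x)) - ∫ y, f y ∂((iterK Kν j) x)|
      ≤ j * (2 / δ * M * tvDist μ ν) :=
        abs_integral_iterK_sub_le Kμ Kν (fun g hg hgM =>
          abs_integral_rebirth_sub_le S hS hδ μ ν hμ hν Kμ Kν hKμ hKν hg hgM) j hf hfM x
    _ ≤ 2 ^ j * (2 / δ * M * tvDist μ ν) := by gcongr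
    _ = (2 / δ) * 2 ^ j * M * tvDist μ ν := by ring
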